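/- Let a and b be two distinct agents. For every call sequence σ in which the call ab does not occur, and every formula φ of L^ck that contains no occurrence of the negation symbol ¬: (M, σ) ⊨ C_{ab} φ if and only if M ⊨ φ. -/

import Mathlib

namespace Gossip

/-- A call between two distinct agents. -/
structure Call (A : Type) where
  x : A
  y : A
  ne : x ≠ y

variable {A : Type} [DecidableEq A]

/-- Agent `a` is involved in the call `c`. -/
def Call.involves (c : Call A) (a : A) : Prop := a = c.x ∨ a = c.y

instance (c : Call A) (a : A) : Decidable (c.involves a) := by
  unfold Call.involves; infer_instance

/-- `c` is the call between agents `a` and `b`. -/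
def Call.isBetween (c : Call A) (a b : A) : Prop :=
  (c.x = a ∧ c.y = b) ∨ (c.x = b ∧ c.y = a)

instance (c : Call A) (a b : A) : Decidable (c.isBetween a b) := by
  unfold Call.isBetween; infer_instance

/-- The effect of a call on a gossip situation: the two agents involved
pool their secrets. -/
def Call.apply (c : Call A) (s : A → Finset A) : A → Finset A :=
  fun d => if d = c.x ∨ d = c.y then s c.x ∪ s c.y else s d

/-- The initial gossip situation: each agent is familiar only with their
own secret (secrets are identified with agents via the fixed bijection). -/
def root : A → Finset A := fun a => {a}

/-- The result of applying a call sequence to a gossip situation. -/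
def applySeq (σ : List (Call A)) (s : A → Finset A) : A → Finset A :=
  σ.foldl (fun t c => c.apply t) s

/-- `∼_a` : the smallest relation with `ε ∼_a ε`, closed under appending
calls not involving `a` on either side, and under appending a call
involving `a` on both sides when it yields the same set of secrets for `a`. -/
inductive AgEquiv (a : A) : List (Call A) → List (Call A) → Prop
  | nil : AgEquiv a [] []
  | extLeft {σ τ : List (Call A)} (c : Call A) :
      ¬ c.involves a → AgEquiv a σ τ → AgEquiv a (σ ++ [c]) τ
  | extRight {σ τ : List (Call A)} (c : Call A) :
      ¬ c.involves a → AgEquiv a σ τ → AgEquiv a σ (τ ++ [c])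
  | call {σ τ : List (Call A)} (c : Call A) :
      c.involves a →
      applySeq (σ ++ [c]) root a = applySeq (τ ++ [c]) root a →
      AgEquiv a σ τ → AgEquiv a (σ ++ [c]) (τ ++ [c])

/-- `∼_G` : reflexive-transitive closure of the union of the `∼_a`, `a ∈ G`. -/
def GEquiv (G : Finset A) : List (Call A) → List (Call A) → Prop :=
  Relation.ReflTransGen (fun σ τ => ∃ a ∈ G, AgEquiv a σ τ)

/-- Formulas of the language `L^ck`. `fam a p` is `F_a p`,
`ck G φ` is `C_G φ`; `K_a φ` is `ck {a} φ`. -/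
inductive Formula (A : Type) where
  | fam : A → A → Formula A
  | neg : Formula A → Formula A
  | conj : Formula A → Formula A → Formula A
  | ck : Finset A → Formula A → Formula A

/-- Truth of a formula at a call sequence (in the gossip model). -/
def Sat : Formula A → List (Call A) → Prop
  | .fam a p, σ => p ∈ applySeq σ root a
  | .neg φ, σ => ¬ Sat φ σ
  | .conj φ ψ, σ => Sat φ σ ∧ Sat ψ σ
  | .ck G φ, σ => ∀ τ, GEquiv G σ τ → Sat φ τ

/-- `M ⊨ φ` : truth at every call sequence. -/
def Truth (φ : Formula A) : Prop := ∀ σ : List (Call A), Sat φ σ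

/-- Formulas with no occurrence of the negation symbol. -/
def NegFree : Formula A → Prop
  | .fam _ _ => True
  | .neg _ => False
  | .conj φ ψ => NegFree φ ∧ NegFree ψ
  | .ck _ φ => NegFree φ

/-- Formulas with no occurrence of the `C_G` modalities (propositional part). -/
def CkFree : Formula A → Prop
  | .fam _ _ => True
  | .neg φ => CkFree φ
  | .conj φ ψ => CkFree φ ∧ CkFree ψ
  | .ck _ _ => False

/-- Formulas of `L_wn`: no nested occurrence of the `C_G` modalities. -/
def NoNested : Formula A → Prop
  | .fam _ _ => True
  | .neg φ => NoNested φ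
  | .conj φ ψ => NoNested φ ∧ NoNested ψ
  | .ck _ φ => CkFree φ

/-- The call `ab` occurs in `σ`. -/
def occursBetween (a b : A) (σ : List (Call A)) : Prop :=
  ∃ c ∈ σ, c.isBetween a b

/-- Epistemic pair-view component `Ṽ(σ)(a,b)`. -/
def pairView (σ : List (Call A)) (a b : A) : Set (A → Finset A) :=
  {s | ∃ τ, GEquiv {a, b} σ τ ∧ s = applySeq τ root}

/-- The full epistemic pair-view `Ṽ(σ)` : all components `Ṽ(σ)(a,b)`
together with the designated situation `Ṽ(σ)(*) = σ(root)`. -/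
def fullView (σ : List (Call A)) : (A → A → Set (A → Finset A)) × (A → Finset A) :=
  (pairView σ, applySeq σ root)

/-- A call sequence is pair-epistemically non-redundant if no nonempty
subsequence `σ₂` of a prefix `σ₁.σ₂` is pair-epistemically redundant. -/
def PairNonRedundant (σ : List (Call A)) : Prop :=
  ∀ σ₁ σ₂ : List (Call A), (σ₁ ++ σ₂) <+: σ → σ₂ ≠ [] →
    fullView σ₁ ≠ fullView (σ₁ ++ σ₂)

/-- Order on gossip situations: componentwise inclusion. -/
def gsLE (s t : A → Finset A) : Prop := ∀ a, s a ⊆ t a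

/-- The order `≤_EPV` on (the pair components of) epistemic pair-views. -/
def epvLE (V W : A → A → Set (A → Finset A)) : Prop :=
  ∀ a b : A, ∃ X : Set (A → Finset A), X ⊆ V a b ∧
    ∃ g : X → W a b, Function.Surjective g ∧ ∀ s : X, gsLE s.1 (g s).1

/-- `σ` is ab-redundant free: no call of `σ` different from the call `ab`
is redundant (leaves the current gossip situation unchanged). -/
def abRedundantFree (a b : A) (σ : List (Call A)) : Prop :=
  ∀ (i : ℕ) (h : i < σ.length), ¬ (σ.get ⟨i, h⟩).isBetween a b →
    (σ.get ⟨i, h⟩).apply (applySeq (σ.take i) root) ≠ applySeq (σ.take i) root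

theorem AgEquiv.refl (a : A) (σ : List (Call A)) : AgEquiv a σ σ := by
  induction σ using List.reverseRecOn with
  | nil => exact .nil
  | append_singleton σ c ih =>
    by_cases hc : c.involves a
    · exact .call c hc rfl ih
    · exact .extLeft c hc (.extRight c hc ih)

theorem Call.isBetween_of_involves {c : Call A} {a b : A} (hab : a ≠ b)
    (ha : c.involves a) (hb : c.involves b) : c.isBetween a b := by
  unfold Call.involves at ha hb
  unfold Call.isBetween
  grind

theorem GEquiv.nil_of_not_occursBetween {a b : A} (hab : a ≠ b) (σ : List (Call A))
    (h : ¬ occursBetween a b σ) : GEquiv {a, b} σ [] := by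
  induction σ using List.reverseRecOn with
  | nil => exact .refl
  | append_singleton σ c ih =>
    have hσ : ¬ occursBetween a b σ := fun ⟨d, hd, hdb⟩ =>
      h ⟨d, List.mem_append_left _ hd, hdb⟩
    refine .head ?_ (ih hσ)
    by_cases ha : c.involves a
    · have hb : ¬ c.involves b := fun hb =>
        h ⟨c, by simp, Call.isBetween_of_involves hab ha hb⟩
      exact ⟨b, by simp, .extLeft c hb (.refl b σ)⟩
    · exact ⟨a, by simp, .extLeft c ha (.refl a σ)⟩

theorem Call.subset_apply (c : Call A) (s : A → Finset A) (a : A) : s a ⊆ c.apply s a := by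
  intro p hp
  unfold Call.apply
  grind

theorem mem_applySeq_root (σ : List (Call A)) (a : A) : a ∈ applySeq σ root a := by
  induction σ using List.reverseRecOn with
  | nil => simp [applySeq, root]
  | append_singleton σ c ih =>
    simpa [applySeq] using c.subset_apply (applySeq σ root) a ih

theorem Truth.of_sat_nil {φ : Formula A} (hφ : NegFree φ) (h : Sat φ []) : Truth φ := by
  induction φ with
  | fam a p =>
    obtain rfl : p = a := by simpa [Sat, applySeq, root] using h
    exact fun σ => mem_applySeq_root σ p
  | neg φ => exact hφ.elim
  | conj φ ψ ihφ ihψ => exact fun σ => ⟨ihφ hφ.1 h.1 σ, ihψ hφ.2 h.2 σ⟩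
  | ck G φ ih => exact fun _ τ _ => ih hφ (h [] .refl) τ

theorem stmt5 {A : Type} [DecidableEq A] [Fintype A] (hA : 3 ≤ Fintype.card A)
    (a b : A) (hab : a ≠ b) (σ : List (Call A)) (h : ¬ occursBetween a b σ)
    (φ : Formula A) (hφ : NegFree φ) :
    Sat (Formula.ck {a, b} φ) σ ↔ Truth φ :=
  ⟨fun hσ => Truth.of_sat_nil hφ (hσ [] (GEquiv.nil_of_not_occursBetween hab σ h)),
    fun hT τ _ => hT τ⟩

end Gossip
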